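/- For any finite set Y ⊆ 𝒳 with |Y| ≥ 4, there is no pairwise voting method with domain {P : X(P) ⊆ Y, ℳ(P) is uniquely weighted, and all weights in ℳ(P) belong to {2,4,6,8,10,12}} satisfying anonymity, neutrality, binary γ, and quasi-resoluteness. -/

import Mathlib

/- Formalization of voting-theoretic notions from Holliday, Norman, Pacuit, Zahedian,
"Impossibility theorems involving weakenings of expansion consistency and resoluteness
in voting". Candidates form an infinite type `C` and voters an infinite type `V`. -/

open Classical

noncomputable section

/-- `L` is a strict linear order on exactly the finite set `s`. -/
def IsStrictLinearOrderOn {C : Type} (s : Finset C) (L : C → C → Prop) : Prop :=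
  (∀ x, ¬ L x x) ∧ (∀ x y z, L x y → L y z → L x z) ∧
    (∀ x ∈ s, ∀ y ∈ s, x ≠ y → L x y ∨ L y x) ∧ ∀ x y, L x y → x ∈ s ∧ y ∈ s

/-- Restriction of a relation to a finite set `A`. -/
def restrictRel {C : Type} (A : Finset C) (L : C → C → Prop) : C → C → Prop :=
  fun x y => L x y ∧ x ∈ A ∧ y ∈ A

theorem IsStrictLinearOrderOn.restrict {C : Type} {s A : Finset C} {L : C → C → Prop}
    (h : IsStrictLinearOrderOn s L) (hA : A ⊆ s) :
    IsStrictLinearOrderOn A (restrictRel A L) := by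
  obtain ⟨hirr, htr, htot, hdom⟩ := h
  refine ⟨fun x hx => hirr x hx.1,
    fun x y z hxy hyz => ⟨htr _ _ _ hxy.1 hyz.1, hxy.2.1, hyz.2.2⟩, ?_,
    fun x y hxy => ⟨hxy.2.1, hxy.2.2⟩⟩
  intro x hx y hy hne
  rcases htot x (hA hx) y (hA hy) hne with h' | h'
  · exact Or.inl ⟨h', hx, hy⟩
  · exact Or.inr ⟨h', hy, hx⟩

/-- The image of a relation under the transposition of `a` and `b`. -/
def swapRel {C : Type} (a b : C) (L : C → C → Prop) : C → C → Prop :=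
  fun x y => L (Equiv.swap a b x) (Equiv.swap a b y)

theorem IsStrictLinearOrderOn.swapRel_mem {C : Type} {s : Finset C} {L : C → C → Prop}
    (a b : C) (h : IsStrictLinearOrderOn s L) :
    IsStrictLinearOrderOn (s.image (Equiv.swap a b)) (swapRel a b L) := by
  obtain ⟨hirr, htr, htot, hdom⟩ := h
  refine ⟨fun x => hirr _, fun x y z hxy hyz => htr _ _ _ hxy hyz, ?_, ?_⟩
  · intro x hx y hy hne
    obtain ⟨x', hx', rfl⟩ := Finset.mem_image.mp hx
    obtain ⟨y', hy', rfl⟩ := Finset.mem_image.mp hy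
    have hne' : x' ≠ y' := by rintro rfl; exact hne rfl
    have := htot x' hx' y' hy' hne'
    simpa [swapRel, Equiv.swap_apply_self] using this
  · intro x y hxy
    obtain ⟨h1, h2⟩ := hdom _ _ hxy
    exact ⟨Finset.mem_image.mpr ⟨_, h1, Equiv.swap_apply_self a b x⟩,
      Finset.mem_image.mpr ⟨_, h2, Equiv.swap_apply_self a b y⟩⟩

/-- A preference profile: each voter in the finite set `voters` submits a strict linear
order of the finite nonempty set `cands` of candidates. -/
structure Profile (C V : Type) where
  voters : Finset V
  cands : Finset C
  cands_nonempty : cands.Nonempty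
  ballot : V → C → C → Prop
  ballot_lin : ∀ i ∈ voters, IsStrictLinearOrderOn cands (ballot i)

namespace Profile

variable {C V : Type}

/-- The margin of `x` over `y` in `P`: the number of voters ranking `x` above `y`
minus the number of voters ranking `y` above `x`. -/
def margin (P : Profile C V) (x y : C) : ℤ :=
  ((P.voters.filter (fun i => P.ballot i x y)).card : ℤ) -
    ((P.voters.filter (fun i => P.ballot i y x)).card : ℤ)

/-- The profile `P^{i⇄j}` obtained by transposing the voters `i` and `j`. -/
def swapVoters (P : Profile C V) (i j : V) : Profile C V where
  voters := P.voters.image (Equiv.swap i j)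
  cands := P.cands
  cands_nonempty := P.cands_nonempty
  ballot := fun k => P.ballot (Equiv.swap i j k)
  ballot_lin := by
    intro k hk
    obtain ⟨m, hm, rfl⟩ := Finset.mem_image.mp hk
    simpa [Equiv.swap_apply_self] using P.ballot_lin m hm

/-- The profile `P_{a⇄b}` obtained by transposing the candidates `a` and `b`. -/
def swapCands (P : Profile C V) (a b : C) : Profile C V where
  voters := P.voters
  cands := P.cands.image (Equiv.swap a b)
  cands_nonempty := P.cands_nonempty.image _
  ballot := fun i => swapRel a b (P.ballot i)
  ballot_lin := fun i hi => (P.ballot_lin i hi).swapRel_mem a b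

/-- The restriction `P|_A` of a profile to a nonempty subset `A` of its candidates. -/
def restrict (P : Profile C V) (A : Finset C) (hA : A.Nonempty) (hsub : A ⊆ P.cands) :
    Profile C V where
  voters := P.voters
  cands := A
  cands_nonempty := hA
  ballot := fun i => restrictRel A (P.ballot i)
  ballot_lin := fun i hi => (P.ballot_lin i hi).restrict hsub

/-- The profile `P_{-y}`, i.e. `P` with the candidate `y` removed. -/
def minus (P : Profile C V) (y : C) (h : (P.cands.erase y).Nonempty) : Profile C V :=
  P.restrict (P.cands.erase y) h (P.cands.erase_subset y)

/-- The profile `P|_{{x,y}}`, i.e. `P` restricted to the two candidates `x` and `y`. -/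
def pair (P : Profile C V) (x y : C) (hx : x ∈ P.cands) (hy : y ∈ P.cands) : Profile C V :=
  P.restrict {x, y} ⟨x, Finset.mem_insert_self x {y}⟩
    (by
      intro z hz
      rcases Finset.mem_insert.mp hz with rfl | hz
      · exact hx
      · rcases Finset.mem_singleton.mp hz with rfl
        exact hy)

/-- `P` is uniquely weighted: no two distinct ordered pairs of distinct candidates
have the same margin. -/
def UniquelyWeighted (P : Profile C V) : Prop :=
  ∀ a ∈ P.cands, ∀ b ∈ P.cands, ∀ x ∈ P.cands, ∀ y ∈ P.cands,
    a ≠ b → x ≠ y → (a, b) ≠ (x, y) → P.margin a b ≠ P.margin x y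

/-- `P` is uniquely ranked: in every subelection with at least two candidates, no two
candidates have the same number of `n`-th place votes, and no two candidates have the
same Borda score. -/
def UniquelyRanked (P : Profile C V) : Prop :=
  ∀ Y ⊆ P.cands, 2 ≤ Y.card →
    ((∀ n : ℕ, 1 ≤ n → n ≤ Y.card → ∀ x ∈ Y, ∀ y ∈ Y, x ≠ y →
        (P.voters.filter
            (fun i => (Y.filter (fun z => P.ballot i z x)).card = n - 1)).card ≠
          (P.voters.filter
            (fun i => (Y.filter (fun z => P.ballot i z y)).card = n - 1)).card) ∧
      (∀ x ∈ Y, ∀ y ∈ Y, x ≠ y →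
        (∑ i ∈ P.voters, (Y.filter (fun z => P.ballot i x z)).card) ≠
          ∑ i ∈ P.voters, (Y.filter (fun z => P.ballot i y z)).card))

/-- `Q` is an `n`-fold copy `nP` of `P`: same candidates, and there is a map sending
the voters of `Q` onto the voters of `P` such that each voter of `P` has exactly `n`
preimages, each with the same ballot. -/
def IsCopy (Q P : Profile C V) (n : ℕ) : Prop :=
  Q.cands = P.cands ∧
    ∃ h : V → V,
      (∀ j ∈ Q.voters, h j ∈ P.voters) ∧
      (∀ i ∈ P.voters, (Q.voters.filter (fun j => h j = i)).card = n) ∧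
      (∀ j ∈ Q.voters, Q.ballot j = P.ballot (h j))

/-- `Q` is obtained from `P` by deleting one voter with each linear order of the
candidates of `P`. -/
def IsCancelOf (Q P : Profile C V) : Prop :=
  Q.cands = P.cands ∧ Q.voters ⊆ P.voters ∧
    (∀ j ∈ Q.voters, Q.ballot j = P.ballot j) ∧
    ∀ L : C → C → Prop, IsStrictLinearOrderOn P.cands L →
      ((P.voters \ Q.voters).filter (fun i => P.ballot i = L)).card = 1

end Profile

/-- A voting method: a function assigning to each profile in a nonempty domain a
nonempty set of winners among its candidates. -/
structure VotingMethod (C V : Type) where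
  dom : Set (Profile C V)
  dom_nonempty : dom.Nonempty
  winners : Profile C V → Finset C
  winners_nonempty : ∀ P ∈ dom, (winners P).Nonempty
  winners_sub : ∀ P ∈ dom, winners P ⊆ P.cands

namespace VotingMethod

variable {C V : Type}

/-- Anonymity: transposing two voters does not change the winners. -/
def Anonymous (F : VotingMethod C V) : Prop :=
  ∀ P ∈ F.dom, ∀ i j : V, P.swapVoters i j ∈ F.dom →
    F.winners (P.swapVoters i j) = F.winners P

/-- Neutrality: transposing two candidates transposes the winners accordingly. -/
def Neutral (F : VotingMethod C V) : Prop :=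
  ∀ P ∈ F.dom, ∀ a b : C, P.swapCands a b ∈ F.dom →
    F.winners (P.swapCands a b) = (F.winners P).image (Equiv.swap a b)

/-- Binary resoluteness: a unique winner in any two-candidate profile. -/
def BinaryResolute (F : VotingMethod C V) : Prop :=
  ∀ P ∈ F.dom, P.cands.card = 2 → (F.winners P).card = 1

/-- Binary quasi-resoluteness: a unique winner in any two-candidate profile whose
two distinct candidates have a nonzero margin between them. -/
def BinaryQuasiResolute (F : VotingMethod C V) : Prop :=
  ∀ P ∈ F.dom, P.cands.card = 2 →
    (∀ x ∈ P.cands, ∀ y ∈ P.cands, x ≠ y → P.margin x y ≠ 0) →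
    (F.winners P).card = 1

/-- Quasi-resoluteness: a unique winner in any uniquely weighted profile. -/
def QuasiResolute (F : VotingMethod C V) : Prop :=
  ∀ P ∈ F.dom, P.UniquelyWeighted → (F.winners P).card = 1

/-- Weak quasi-resoluteness: a unique winner in any profile that is both uniquely
weighted and uniquely ranked. -/
def WeakQuasiResolute (F : VotingMethod C V) : Prop :=
  ∀ P ∈ F.dom, P.UniquelyWeighted → P.UniquelyRanked → (F.winners P).card = 1

/-- Binary γ: if `x` wins without `y` and wins the head-to-head against `y`,
then `x` wins with `y` included. -/
def BinaryGamma (F : VotingMethod C V) : Prop :=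
  ∀ P ∈ F.dom, ∀ x, ∀ hx : x ∈ P.cands, ∀ y, ∀ hy : y ∈ P.cands, x ≠ y →
    ∀ h : (P.cands.erase y).Nonempty,
      P.minus y h ∈ F.dom → P.pair x y hx hy ∈ F.dom →
      x ∈ F.winners (P.minus y h) → F.winners (P.pair x y hx hy) = {x} →
      x ∈ F.winners P

/-- α-resoluteness: if `x` wins without `y` and wins the head-to-head against `y`,
then adding `y` does not enlarge the set of winners. -/
def AlphaResolute (F : VotingMethod C V) : Prop :=
  ∀ P ∈ F.dom, ∀ x, ∀ hx : x ∈ P.cands, ∀ y, ∀ hy : y ∈ P.cands, x ≠ y →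
    ∀ h : (P.cands.erase y).Nonempty,
      P.minus y h ∈ F.dom → P.pair x y hx hy ∈ F.dom →
      x ∈ F.winners (P.minus y h) → F.winners (P.pair x y hx hy) = {x} →
      (F.winners P).card ≤ (F.winners (P.minus y h)).card

/-- Homogeneity: replacing each voter by `n` copies of that voter does not change
the winners. -/
def Homogeneous (F : VotingMethod C V) : Prop :=
  ∀ P ∈ F.dom, ∀ Q ∈ F.dom, ∀ n : ℕ, 0 < n → Q.IsCopy P n → F.winners Q = F.winners P

/-- Cancellativity: deleting one voter with each linear order of the candidates does
not change the winners. -/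
def Cancellative (F : VotingMethod C V) : Prop :=
  ∀ P ∈ F.dom, ∀ Q ∈ F.dom, Q.IsCancelOf P → F.winners Q = F.winners P

/-- Majoritarianism: the winners depend only on the majority graph of the profile. -/
def Majoritarian (F : VotingMethod C V) : Prop :=
  ∀ P ∈ F.dom, ∀ P' ∈ F.dom, P.cands = P'.cands →
    (∀ x ∈ P.cands, ∀ y ∈ P.cands, (0 < P.margin x y ↔ 0 < P'.margin x y)) →
    F.winners P = F.winners P'

/-- Pairwiseness: the winners depend only on the margin graph of the profile. -/
def Pairwise (F : VotingMethod C V) : Prop :=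
  ∀ P ∈ F.dom, ∀ P' ∈ F.dom, P.cands = P'.cands →
    (∀ x ∈ P.cands, ∀ y ∈ P.cands, P.margin x y = P'.margin x y) →
    F.winners P = F.winners P'

end VotingMethod

namespace NPM

variable {C V : Type}

theorem comb_aux (A : Fin 6 → Fin 6 → Fin 6 → Prop)
    (D : ∀ w p q, w ≠ p → w ≠ q → p ≠ q → A w p q ∨ A p q w ∨ A q w p)
    (K : ∀ w p q r s, [w, p, q, r, s].Nodup → A w p q → A r s w → False) (h : A 0 1 2) :
    False := by
  have a1 : ¬ A 2 5 3 := fun g => K 2 5 3 0 1 (by decide) g h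
  have a2 : ¬ A 2 3 4 := fun g => K 2 3 4 0 1 (by decide) g h
  have a3 : ¬ A 4 5 0 := fun g => K 0 1 2 4 5 (by decide) h g
  have a4 : ¬ A 5 4 0 := fun g => K 0 1 2 5 4 (by decide) h g
  have a5 : ¬ A 5 3 0 := fun g => K 0 1 2 5 3 (by decide) h g
  rcases D 0 1 3 (by decide) (by decide) (by decide) with g | g | g
  · have b1 : ¬ A 3 2 5 := fun k => K 3 2 5 0 1 (by decide) k g
    have b2 : ¬ A 3 4 2 := fun k => K 3 4 2 0 1 (by decide) k g
    have b3 : A 5 3 2 := by have := D 5 3 2 (by decide) (by decide) (by decide); tauto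
    have b4 : A 4 2 3 := by have := D 4 2 3 (by decide) (by decide) (by decide); tauto
    have b5 : ¬ A 5 0 4 := fun k => K 4 2 3 5 0 (by decide) b4 k
    have b6 : ¬ A 0 4 5 := fun k => K 5 3 2 0 4 (by decide) b3 k
    have := D 5 0 4 (by decide) (by decide) (by decide)
    tauto
  · have b1 : ¬ A 0 4 5 := fun k => K 0 4 5 1 3 (by decide) k g
    have b2 : ¬ A 0 5 4 := fun k => K 0 5 4 1 3 (by decide) k g
    have b3 : A 5 0 4 := by have := D 5 0 4 (by decide) (by decide) (by decide); tauto
    have b4 : A 4 0 5 := by have := D 4 0 5 (by decide) (by decide) (by decide); tauto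
    have b5 : ¬ A 5 3 2 := fun k => K 5 3 2 4 0 (by decide) k b4
    have b6 : ¬ A 3 2 5 := fun k => K 5 0 4 3 2 (by decide) b3 k
    have := D 5 3 2 (by decide) (by decide) (by decide)
    tauto
  · have b1 : ¬ A 4 2 3 := fun k => K 3 0 1 4 2 (by decide) g k
    have b2 : A 3 4 2 := by have := D 3 4 2 (by decide) (by decide) (by decide); tauto
    have b3 : ¬ A 0 5 3 := fun k => K 3 4 2 0 5 (by decide) b2 k
    have b4 : A 3 0 5 := by have := D 3 0 5 (by decide) (by decide) (by decide); tauto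
    have b5 : ¬ A 5 1 2 := fun k => K 5 1 2 3 0 (by decide) k b4
    have b6 : ¬ A 1 2 5 := fun k => K 1 2 5 3 0 (by decide) k g
    have b7 : ¬ A 2 5 1 := fun k => K 2 5 1 3 4 (by decide) k b2
    have := D 5 1 2 (by decide) (by decide) (by decide)
    tauto

theorem comb (A : Fin 6 → Fin 6 → Fin 6 → Prop)
    (D : ∀ w p q, w ≠ p → w ≠ q → p ≠ q → A w p q ∨ A p q w ∨ A q w p)
    (K : ∀ w p q r s, [w, p, q, r, s].Nodup → A w p q → A r s w → False) : False := by
  have key : ∀ f : Fin 6 → Fin 6, Function.Injective f → A (f 0) (f 1) (f 2) → False := by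
    intro f hf h
    apply comb_aux (fun i j k => A (f i) (f j) (f k)) _ _ h
    · intro w p q h1 h2 h3
      exact D _ _ _ (hf.ne h1) (hf.ne h2) (hf.ne h3)
    · intro w p q r s hn
      exact K _ _ _ _ _ (hn.map hf)
  rcases D 0 1 2 (by decide) (by decide) (by decide) with g | g | g
  · exact key ![0, 1, 2, 3, 4, 5] (by decide) g
  · exact key ![1, 2, 0, 3, 4, 5] (by decide) g
  · exact key ![2, 0, 1, 3, 4, 5] (by decide) g

/-- the indicator matrix of a linear order -/
def ind (L : C → C → Prop) (x y : C) : ℤ := (if L x y then 1 else 0) - (if L y x then 1 else 0)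

theorem add_voter [Infinite V] (P : Profile C V) (L : C → C → Prop)
    (hL : IsStrictLinearOrderOn P.cands L) :
    ∃ Q : Profile C V, Q.cands = P.cands ∧ ∀ x y, Q.margin x y = P.margin x y + ind L x y := by
  obtain ⟨v, hv⟩ := Infinite.exists_notMem_finset P.voters
  refine ⟨⟨insert v P.voters, P.cands, P.cands_nonempty, Function.update P.ballot v L, ?_⟩, rfl, ?_⟩
  · intro i hi
    by_cases h : i = v
    · subst h; simpa using hL
    · simp only [Finset.mem_insert, h, false_or] at hi
      simpa [Function.update, h] using P.ballot_lin i hi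
  · intro x y
    have key : ∀ x y, ((((insert v P.voters).filter
        (fun i => Function.update P.ballot v L i x y)).card : ℕ) : ℤ)
        = ((P.voters.filter (fun i => P.ballot i x y)).card : ℤ) + (if L x y then 1 else 0) := by
      intro x y
      have e : P.voters.filter (fun i => Function.update P.ballot v L i x y)
          = P.voters.filter (fun i => P.ballot i x y) := by
        apply Finset.filter_congr
        intro i hi
        have : i ≠ v := by rintro rfl; exact hv hi
        simp [Function.update, this]
      rw [Finset.filter_insert, e]
      by_cases h : L x y
      · simp [h, hv]
      · simp [h]
    unfold Profile.margin ind
    simp only [key]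
    ring

def ofRank (X : Finset C) (r : C → ℤ) : C → C → Prop := fun x y => x ∈ X ∧ y ∈ X ∧ r x < r y

theorem ofRank_lin (X : Finset C) (r : C → ℤ) (hr : Set.InjOn r X) :
    IsStrictLinearOrderOn X (ofRank X r) := by
  refine ⟨fun x h => lt_irrefl _ h.2.2, fun x y z h h' => ⟨h.1, h'.2.1, h.2.2.trans h'.2.2⟩, ?_,
    fun x y h => ⟨h.1, h.2.1⟩⟩
  intro x hx y hy hne
  rcases lt_trichotomy (r x) (r y) with h | h | h
  · exact Or.inl ⟨hx, hy, h⟩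
  · exact absurd (hr hx hy h) hne
  · exact Or.inr ⟨hy, hx, h⟩

def elem (x y : C) (u v : C) : ℤ :=
  if u = x ∧ v = y then 1 else if u = y ∧ v = x then -1 else 0

def Ach (V : Type) (X : Finset C) (m : C → C → ℤ) : Prop :=
  ∃ P : Profile C V, P.cands = X ∧ ∀ x ∈ X, ∀ y ∈ X, P.margin x y = m x y

theorem Ach.step [Infinite V] {X : Finset C} {m : C → C → ℤ} (h : Ach V X m) (x y : C)
    (hxy : x ≠ y) : Ach V X (fun u v => m u v + 2 * elem x y u v) := by
  obtain ⟨P, rfl, hP⟩ := h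
  obtain ⟨r, hr⟩ := Set.countable_iff_exists_injOn.1 P.cands.finite_toSet.countable
  have h1 : IsStrictLinearOrderOn P.cands (ofRank P.cands
      (fun z => if z = x then -2 else if z = y then -1 else (r z : ℤ))) := by
    apply ofRank_lin
    intro u hu v hv h
    have := @hr u hu v hv
    dsimp only at h
    split_ifs at h <;> first | omega | (subst_vars; rfl) | (apply this; omega)
  have h2 : IsStrictLinearOrderOn P.cands (ofRank P.cands
      (fun z => if z = x then 1 else if z = y then 2 else -(r z : ℤ))) := by
    apply ofRank_lin
    intro u hu v hv h
    have := @hr u hu v hv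
    dsimp only at h
    split_ifs at h <;> first | omega | (subst_vars; rfl) | (apply this; omega)
  obtain ⟨Q, hQ, hQm⟩ := add_voter P _ h1
  obtain ⟨R, hR, hRm⟩ := add_voter Q _ (hQ ▸ h2)
  refine ⟨R, hR.trans hQ, ?_⟩
  intro u hu v hv
  rw [hRm, hQm, hP u hu v hv, add_assoc]
  congr 1
  have := @hr u hu v hv
  simp only [ind, ofRank, hu, hv, true_and, elem]
  by_cases ux : u = x <;> by_cases uy : u = y <;> by_cases vx : v = x <;> by_cases vy : v = y <;>
    by_cases uv : u = v <;>
    first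
    | (exfalso; grind)
    | (have : r u ≠ r v := fun h => uv (this h)
       simp only [ux, uy, vx, vy, uv, if_true, if_false, and_true, and_false, true_and, false_and]
       split_ifs <;> first | omega | grind)
    | (simp only [ux, uy, vx, vy, uv, if_true, if_false, and_true, and_false, true_and, false_and]
       split_ifs <;> first | omega | grind)

theorem Ach.add [Infinite V] {X : Finset C} {m : C → C → ℤ} (h : Ach V X m) (x y : C)
    (hxy : x ≠ y) (k : ℤ) : Ach V X (fun u v => m u v + 2 * k * elem x y u v) := by
  have nat : ∀ (n : ℕ) (x y : C), x ≠ y → Ach V X (fun u v => m u v + 2 * n * elem x y u v) := by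
    intro n x y hxy
    induction n with
    | zero => simpa using h
    | succ n ih =>
      have := ih.step x y hxy
      convert this using 3
      push_cast; ring
  have neg : ∀ u v, elem y x u v = - elem x y u v := by
    intro u v; unfold elem; grind
  obtain ⟨n, rfl | rfl⟩ := k.eq_nat_or_neg
  · exact nat n x y hxy
  · have := nat n y x hxy.symm
    simp only [neg] at this
    convert this using 3
    ring

theorem Ach.zero (X : Finset C) (hX : X.Nonempty) : Ach V X (fun _ _ => 0) := by
  refine ⟨⟨∅, X, hX, fun _ _ _ => False, by simp⟩, rfl, ?_⟩
  intro x _ y _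
  simp [Profile.margin]

theorem margin_neg (P : Profile C V) (x y : C) : P.margin x y = - P.margin y x := by
  unfold Profile.margin; ring

theorem exists_profile [Infinite V] (a b c d : C) (hn : [a, b, c, d].Nodup)
    (kab kac kad kbc kbd kcd : ℤ) :
    ∃ P : Profile C V, P.cands = {a, b, c, d} ∧ P.margin a b = 2 * kab ∧ P.margin a c = 2 * kac ∧
      P.margin a d = 2 * kad ∧ P.margin b c = 2 * kbc ∧ P.margin b d = 2 * kbd ∧
      P.margin c d = 2 * kcd := by
  simp only [List.nodup_cons, List.mem_cons, List.not_mem_nil, not_or] at hn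
  obtain ⟨⟨h1, h2, h3, -⟩, ⟨h4, h5, -⟩, ⟨h6, -⟩, -⟩ := hn
  have h := ((((((Ach.zero (V := V) {a, b, c, d} ⟨a, by simp⟩).add a b h1 kab).add a c h2 kac).add
    a d h3 kad).add b c h4 kbc).add b d h5 kbd).add c d h6 kcd
  obtain ⟨P, hP, hm⟩ := h
  have g1 := Ne.symm h1
  have g2 := Ne.symm h2
  have g3 := Ne.symm h3
  have g4 := Ne.symm h4
  have g5 := Ne.symm h5
  have g6 := Ne.symm h6
  refine ⟨P, hP, ?_, ?_, ?_, ?_, ?_, ?_⟩ <;> rw [hm _ (by simp) _ (by simp)] <;>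
    simp [elem, h1, h2, h3, h4, h5, h6, g1, g2, g3, g4, g5, g6]

def Dom (V : Type) (Y : Finset C) : Set (Profile C V) :=
  {P : Profile C V | P.cands ⊆ Y ∧ P.UniquelyWeighted ∧
        ∀ x ∈ P.cands, ∀ y ∈ P.cands, 0 < P.margin x y →
          P.margin x y ∈ ({2, 4, 6, 8, 10, 12} : Set ℤ)}

theorem margin_restrict (P : Profile C V) (A : Finset C) (hA) (hs) (x y : C) (hx : x ∈ A)
    (hy : y ∈ A) : (P.restrict A hA hs).margin x y = P.margin x y := by
  simp [Profile.margin, Profile.restrict, restrictRel, hx, hy]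

theorem dom_restrict {Y : Finset C} (P : Profile C V) (hP : P ∈ Dom V Y) (A : Finset C) (hA) (hs) :
    P.restrict A hA hs ∈ Dom V Y := by
  obtain ⟨h1, h2, h3⟩ := hP
  refine ⟨fun x hx => h1 (hs hx), ?_, ?_⟩
  · intro a ha b hb x hx y hy h h' h''
    rw [margin_restrict _ _ _ _ _ _ (id ha : a ∈ A) (id hb : b ∈ A),
      margin_restrict _ _ _ _ _ _ (id hx : x ∈ A) (id hy : y ∈ A)]
    exact h2 a (hs ha) b (hs hb) x (hs hx) y (hs hy) h h' h''
  · intro x hx y hy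
    rw [margin_restrict _ _ _ _ _ _ (id hx : x ∈ A) (id hy : y ∈ A)]
    exact h3 x (hs hx) y (hs hy)

theorem margin_swap (P : Profile C V) (a b x y : C) :
    (P.swapCands a b).margin x y = P.margin (Equiv.swap a b x) (Equiv.swap a b y) := by
  rfl

theorem swap_mem {Y : Finset C} {a b x : C} (ha : a ∈ Y) (hb : b ∈ Y) (hx : x ∈ Y) :
    Equiv.swap a b x ∈ Y := by
  rw [Equiv.swap_apply_def]; split_ifs <;> assumption

theorem dom_swap {Y : Finset C} (P : Profile C V) (hP : P ∈ Dom V Y) (a b : C) (ha : a ∈ Y)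
    (hb : b ∈ Y) : P.swapCands a b ∈ Dom V Y := by
  obtain ⟨h1, h2, h3⟩ := hP
  have hc : ∀ x, x ∈ (P.swapCands a b).cands → Equiv.swap a b x ∈ P.cands := by
    intro x hx
    obtain ⟨z, hz, rfl⟩ := Finset.mem_image.1 hx
    simpa using hz
  refine ⟨?_, ?_, ?_⟩
  · intro x hx
    have := swap_mem ha hb (h1 (hc x hx))
    simpa using this
  · intro u hu v hv x hx y hy h h' h''
    rw [margin_swap, margin_swap]
    refine h2 _ (hc _ hu) _ (hc _ hv) _ (hc _ hx) _ (hc _ hy) (by simpa using h) (by simpa using h') ?_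
    simpa using h''
  · intro x hx y hy
    rw [margin_swap]
    exact h3 _ (hc _ hx) _ (hc _ hy)

/-- `σ` acts on the domain compatibly with `F`. -/
def Good (F : VotingMethod C V) (Y : Finset C) (σ : Equiv.Perm C) : Prop :=
  (∀ x ∈ Y, σ x ∈ Y) ∧ ∀ P ∈ F.dom, ∃ Q ∈ F.dom, Q.cands = P.cands.image σ ∧
    (∀ x y, Q.margin (σ x) (σ y) = P.margin x y) ∧ F.winners Q = (F.winners P).image σ

theorem Good.swap {F : VotingMethod C V} {Y : Finset C} (hd : F.dom = Dom V Y) (hN : F.Neutral)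
    {a b : C} (ha : a ∈ Y) (hb : b ∈ Y) : Good F Y (Equiv.swap a b) := by
  refine ⟨fun x hx => swap_mem ha hb hx, fun P hP => ?_⟩
  have h : P.swapCands a b ∈ F.dom := by rw [hd] at hP ⊢; exact dom_swap P hP a b ha hb
  refine ⟨_, h, ?_, ?_, ?_⟩
  · simp [Profile.swapCands]
  · intro x y; simp [margin_swap]
  · rw [hN P hP a b h]

theorem Good.mul {F : VotingMethod C V} {Y : Finset C} {σ τ : Equiv.Perm C} (hσ : Good F Y σ)
    (hτ : Good F Y τ) : Good F Y (τ * σ) := by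
  refine ⟨fun x hx => hτ.1 _ (hσ.1 _ hx), fun P hP => ?_⟩
  obtain ⟨Q, hQ, h1, h2, h3⟩ := hσ.2 P hP
  obtain ⟨R, hR, g1, g2, g3⟩ := hτ.2 Q hQ
  refine ⟨R, hR, ?_, ?_, ?_⟩
  · rw [g1, h1, Finset.image_image]; rfl
  · intro x y; rw [← h2 x y, ← g2]; rfl
  · rw [g3, h3, Finset.image_image]; rfl

theorem good2 {F : VotingMethod C V} {Y : Finset C} (hd : F.dom = Dom V Y) (hN : F.Neutral)
    {a b a' b' : C} (ha : a ∈ Y) (hb : b ∈ Y) (ha' : a' ∈ Y) (hb' : b' ∈ Y) (h : a ≠ b)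
    (h' : a' ≠ b') : ∃ σ, Good F Y σ ∧ σ a = a' ∧ σ b = b' := by
  have g := Good.swap hd hN ha ha'
  refine ⟨_, g.mul (Good.swap hd hN (g.1 b hb) hb'), ?_, ?_⟩
  · simp only [Equiv.Perm.mul_apply, Equiv.swap_apply_left]
    apply Equiv.swap_apply_of_ne_of_ne _ h'
    intro e
    apply h
    apply (Equiv.swap a a').injective
    simpa using e
  · simp

theorem good3 {F : VotingMethod C V} {Y : Finset C} (hd : F.dom = Dom V Y) (hN : F.Neutral)
    {a b c a' b' c' : C} (ha : a ∈ Y) (hb : b ∈ Y) (hc : c ∈ Y) (ha' : a' ∈ Y) (hb' : b' ∈ Y)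
    (hc' : c' ∈ Y) (h : [a, b, c].Nodup) (h' : [a', b', c'].Nodup) :
    ∃ σ, Good F Y σ ∧ σ a = a' ∧ σ b = b' ∧ σ c = c' := by
  simp only [List.nodup_cons, List.mem_cons, List.not_mem_nil, not_or] at h h'
  obtain ⟨σ, g, e1, e2⟩ := good2 hd hN ha hb ha' hb' h.1.1 h'.1.1
  refine ⟨_, g.mul (Good.swap hd hN (g.1 c hc) hc'), ?_, ?_, ?_⟩
  · simp only [Equiv.Perm.mul_apply, e1]
    apply Equiv.swap_apply_of_ne_of_ne _ h'.1.2.1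
    rw [← e1]
    exact fun e => h.1.2.1 (σ.injective e)
  · simp only [Equiv.Perm.mul_apply, e2]
    apply Equiv.swap_apply_of_ne_of_ne _ h'.2.1.1
    rw [← e2]
    exact fun e => h.2.1.1 (σ.injective e)
  · simp

/-- in a two-candidate profile, margin `u` means winning -/
def B (F : VotingMethod C V) (Y : Finset C) (u : ℤ) : Prop :=
  ∀ x ∈ Y, ∀ y ∈ Y, x ≠ y → ∀ P ∈ F.dom, P.cands = {x, y} → P.margin x y = u → F.winners P = {x}

/-- in a 3-cycle with margins `u, v, w`, the head of the `u` edge wins -/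
def A (F : VotingMethod C V) (Y : Finset C) (u v w : ℤ) : Prop :=
  ∀ a ∈ Y, ∀ b ∈ Y, ∀ c ∈ Y, [a, b, c].Nodup → ∀ P ∈ F.dom, P.cands = {a, b, c} →
    P.margin a b = u → P.margin b c = v → P.margin c a = w → F.winners P = {b}

theorem margin_self (P : Profile C V) (x : C) : P.margin x x = 0 := by
  simp [Profile.margin]

theorem B_or {F : VotingMethod C V} {Y : Finset C} (hd : F.dom = Dom V Y) (hN : F.Neutral)
    (hPw : F.Pairwise) (hQ : F.QuasiResolute) (u : ℤ) : B F Y u ∨ B F Y (-u) := by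
  by_contra! h
  obtain ⟨h1, h2⟩ := h
  unfold B at h1 h2
  push Not at h1 h2
  obtain ⟨x, hx, y, hy, hxy, P, hP, hc, hm, hw⟩ := h1
  obtain ⟨x', hx', y', hy', hxy', P', hP', hc', hm', hw'⟩ := h2
  have win : ∀ x y : C, ∀ P ∈ F.dom, P.cands = {x, y} → F.winners P ≠ {x} → F.winners P = {y} := by
    intro x y P hP hc hw
    obtain ⟨z, hz⟩ := Finset.card_eq_one.1 (hQ P hP (by rw [hd] at hP; exact hP.2.1))
    have := F.winners_sub P hP
    rw [hz, hc] at this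
    simp at this
    rcases this with rfl | rfl
    · exact absurd hz hw
    · exact hz
  have w := win x y P hP hc hw
  have w' := win x' y' P' hP' hc' hw'
  obtain ⟨σ, g, e1, e2⟩ := good2 hd hN hx hy hy' hx' hxy hxy'.symm
  obtain ⟨R, hR, r1, r2, r3⟩ := g.2 P hP
  have m1 : R.margin y' x' = u := by rw [← e1, ← e2, r2, hm]
  have m2 := margin_neg R x' y'
  have m3 := margin_neg P' y' x'
  have rc : R.cands = {y', x'} := by rw [r1, hc]; simp [Finset.image_insert, e1, e2]
  have : F.winners R = F.winners P' := by
    apply hPw R hR P' hP'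
    · rw [rc, hc', Finset.pair_comm]
    · intro s hs t ht
      rw [rc] at hs ht
      simp only [Finset.mem_insert, Finset.mem_singleton] at hs ht
      rcases hs with rfl | rfl <;> rcases ht with rfl | rfl <;>
        (try simp only [margin_self]) <;> omega
  rw [r3, w, w'] at this
  simp [e2] at this
  exact hxy' this

theorem A_or {F : VotingMethod C V} {Y : Finset C} (hd : F.dom = Dom V Y) (hN : F.Neutral)
    (hPw : F.Pairwise) (hQ : F.QuasiResolute) (u v w : ℤ) :
    A F Y u v w ∨ A F Y v w u ∨ A F Y w u v := by
  have main : ∀ a ∈ Y, ∀ b ∈ Y, ∀ c ∈ Y, [a, b, c].Nodup → ∀ P ∈ F.dom, P.cands = {a, b, c} →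
      ∀ u v w, P.margin a b = u → P.margin b c = v → P.margin c a = w → F.winners P = {b} →
      A F Y u v w := by
    intro a ha b hb c hc hn P hP hcs u v w hu hv hw hwin a' ha' b' hb' c' hc' hn' P' hP' hcs' hu' hv' hw'
    obtain ⟨σ, g, e1, e2, e3⟩ := good3 hd hN ha hb hc ha' hb' hc' hn hn'
    obtain ⟨R, hR, r1, r2, r3⟩ := g.2 P hP
    have m1 : R.margin a' b' = u := by rw [← e1, ← e2, r2, hu]
    have m2 : R.margin b' c' = v := by rw [← e2, ← e3, r2, hv]
    have m3 : R.margin c' a' = w := by rw [← e1, ← e3, r2, hw]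
    have rc : R.cands = {a', b', c'} := by rw [r1, hcs]; simp [Finset.image_insert, e1, e2, e3]
    have : F.winners R = F.winners P' := by
      apply hPw R hR P' hP'
      · rw [rc, hcs']
      · have q1 := margin_neg R a' b'
        have q2 := margin_neg R b' c'
        have q3 := margin_neg R c' a'
        have q1' := margin_neg P' a' b'
        have q2' := margin_neg P' b' c'
        have q3' := margin_neg P' c' a'
        intro s hs t ht
        rw [rc] at hs ht
        simp only [Finset.mem_insert, Finset.mem_singleton] at hs ht
        rcases hs with hs | hs | hs <;> rcases ht with ht | ht | ht <;> rw [hs, ht] <;>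
          (try simp only [margin_self]) <;> omega
    rw [← this, r3, hwin]
    simp [e2]
  by_cases h : ∃ a ∈ Y, ∃ b ∈ Y, ∃ c ∈ Y, [a, b, c].Nodup ∧ ∃ P ∈ F.dom, P.cands = {a, b, c} ∧
    P.margin a b = u ∧ P.margin b c = v ∧ P.margin c a = w
  · obtain ⟨a, ha, b, hb, c, hc, hn, P, hP, hcs, hu, hv, hw⟩ := h
    obtain ⟨z, hz⟩ := Finset.card_eq_one.1 (hQ P hP (by rw [hd] at hP; exact hP.2.1))
    have := F.winners_sub P hP
    rw [hz, hcs] at this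
    simp at this
    have n1 : [b, c, a].Nodup := by simp at hn ⊢; grind
    have n2 : [c, a, b].Nodup := by simp at hn ⊢; grind
    have s1 : P.cands = {b, c, a} := by rw [hcs]; ext; simp; tauto
    have s2 : P.cands = {c, a, b} := by rw [hcs]; ext; simp; tauto
    rcases this with rfl | rfl | rfl
    · exact Or.inr (Or.inr (main _ hc _ ha _ hb n2 P hP s2 _ _ _ hw hu hv hz))
    · exact Or.inl (main _ ha _ hb _ hc hn P hP hcs _ _ _ hu hv hw hz)
    · exact Or.inr (Or.inl (main _ hb _ hc _ ha n1 P hP s1 _ _ _ hv hw hu hz))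
  · left
    intro a ha b hb c hc hn P hP hcs hu hv hw
    exact absurd ⟨a, ha, b, hb, c, hc, hn, P, hP, hcs, hu, hv, hw⟩ h

theorem uw4 (P : Profile C V) (a b c d : C) (hc : P.cands = {a, b, c, d})
    (hn : [|P.margin a b|, |P.margin a c|, |P.margin a d|, |P.margin b c|, |P.margin b d|,
      |P.margin c d|, 0].Nodup) : P.UniquelyWeighted := by
  have key : ∀ x y, |P.margin x y| = |P.margin y x| := fun x y => by rw [margin_neg, abs_neg]
  have h0 : ∀ x ∈ P.cands, ∀ y ∈ P.cands, x ≠ y → |P.margin x y| ≠ 0 := by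
    rw [hc]
    intro x hx y hy
    simp only [Finset.mem_insert, Finset.mem_singleton] at hx hy
    have k1 := key a b
    have k2 := key a c
    have k3 := key a d
    have k4 := key b c
    have k5 := key b d
    have k6 := key c d
    simp only [List.nodup_cons, List.mem_cons, List.not_mem_nil, not_or] at hn
    rcases hx with rfl | rfl | rfl | rfl <;> rcases hy with rfl | rfl | rfl | rfl <;> grind only
  have h1 : ∀ x ∈ P.cands, ∀ y ∈ P.cands, ∀ z ∈ P.cands, ∀ t ∈ P.cands, x ≠ y → z ≠ t →
      |P.margin x y| = |P.margin z t| → (x = z ∧ y = t) ∨ (x = t ∧ y = z) := by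
    rw [hc]
    have k1 := key a b
    have k2 := key a c
    have k3 := key a d
    have k4 := key b c
    have k5 := key b d
    have k6 := key c d
    simp only [List.nodup_cons, List.mem_cons, List.not_mem_nil, not_or] at hn
    intro x hx y hy z hz t ht hxy hzt h
    simp only [Finset.mem_insert, Finset.mem_singleton] at hx hy hz ht
    rcases hx with rfl | rfl | rfl | rfl <;> rcases hy with rfl | rfl | rfl | rfl <;>
    rcases hz with rfl | rfl | rfl | rfl <;> rcases ht with rfl | rfl | rfl | rfl <;>
    first
    | exact absurd rfl hxy
    | exact absurd rfl hzt
    | exact Or.inl ⟨rfl, rfl⟩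
    | exact Or.inr ⟨rfl, rfl⟩
    | (exfalso; grind only)
  intro x hx y hy z hz t ht hxy hzt hne h
  rcases h1 x hx y hy z hz t ht hxy hzt (by rw [h]) with ⟨rfl, rfl⟩ | ⟨rfl, rfl⟩
  · exact hne rfl
  · have := margin_neg P x y
    apply h0 x hx y hy hxy
    have : P.margin x y = 0 := by omega
    simp [this]

theorem main (C V : Type) [Infinite V]
    (Y : Finset C) (hY : 4 ≤ Y.card) (F : VotingMethod C V) (hd : F.dom = Dom V Y)
    (hPw : F.Pairwise) (hN : F.Neutral) (hB : F.BinaryGamma) (hQ : F.QuasiResolute) : False := by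
  have hS : ∀ i : Fin 6, ∃ s : ℤ, B F Y s ∧ (s = 2 * ((i : ℕ) + 1 : ℤ) ∨ s = - (2 * ((i : ℕ) + 1 : ℤ))) := by
    intro i
    rcases B_or hd hN hPw hQ (2 * ((i : ℕ) + 1 : ℤ)) with h | h
    · exact ⟨_, h, Or.inl rfl⟩
    · exact ⟨_, h, Or.inr rfl⟩
  choose S hSB hS using hS
  have hSabs : ∀ i, |S i| = 2 * ((i : ℕ) + 1 : ℤ) := by
    intro i
    rcases hS i with h | h <;> rw [h]
    · exact abs_of_nonneg (by positivity)
    · rw [abs_neg]; exact abs_of_nonneg (by positivity)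
  apply comb (fun i j k => A F Y (S i) (S j) (S k))
  · intro w p q _ _ _
    exact A_or hd hN hPw hQ _ _ _
  intro w p q r s hn hA1 hA2
  obtain ⟨t, ht⟩ : ∃ t, [w, p, q, r, s, t].Nodup := by
    obtain ⟨t, -, ht⟩ : ∃ t ∈ (Finset.univ : Finset (Fin 6)), t ∉ [w, p, q, r, s].toFinset := by
      apply Finset.exists_mem_notMem_of_card_lt_card
      calc _ ≤ 5 := List.toFinset_card_le _
        _ < _ := by simp
    refine ⟨t, ?_⟩
    simp only [List.mem_toFinset, List.nodup_cons, List.mem_cons, List.not_mem_nil, not_or] at ht hn ⊢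
    grind
  obtain ⟨T, hTY, hT⟩ := Finset.exists_subset_card_eq hY
  obtain ⟨a, b, c, d, hab, hac, had, hbc, hbd, hcd, rfl⟩ := Finset.card_eq_four.1 hT
  have ha : a ∈ Y := hTY (by simp)
  have hb : b ∈ Y := hTY (by simp)
  have hc : c ∈ Y := hTY (by simp)
  have hdd : d ∈ Y := hTY (by simp)
  have ev : ∀ i, ∃ k, S i = 2 * k := by
    intro i
    rcases hS i with h | h
    · exact ⟨_, h⟩
    · exact ⟨-((i : ℕ) + 1 : ℤ), by rw [h]; ring⟩
  choose k hk using ev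
  obtain ⟨P, hcs, m1, m2, m3, m4, m5, m6⟩ := exists_profile (V := V) a b c d
    (by simp [hab, hac, had, hbc, hbd, hcd]) (k r) (k p) (-(k w)) (k t) (k s) (k q)
  rw [mul_neg] at m3
  rw [← hk] at m1 m2 m3 m4 m5 m6
  have hPd : P ∈ F.dom := by
    rw [hd]
    refine ⟨hcs ▸ hTY, ?_, ?_⟩
    · apply uw4 P a b c d hcs
      rw [m1, m2, m3, m4, m5, m6, abs_neg]
      simp only [hSabs]
      simp only [List.nodup_cons, List.mem_cons, List.not_mem_nil, not_or, Fin.ext_iff,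
        List.nodup_nil, not_false_eq_true, and_true] at ht ⊢
      omega
    · have W : ∀ i, 0 < S i → S i ∈ ({2, 4, 6, 8, 10, 12} : Set ℤ) := by
        intro i hi
        have := hS i
        have := i.2
        simp only [Set.mem_insert_iff, Set.mem_singleton_iff]
        omega
      have W' : ∀ i, 0 < -S i → -S i ∈ ({2, 4, 6, 8, 10, 12} : Set ℤ) := by
        intro i hi
        have := hS i
        have := i.2
        simp only [Set.mem_insert_iff, Set.mem_singleton_iff]
        omega
      have n1 := margin_neg P b a
      have n2 := margin_neg P c a
      have n3 := margin_neg P d a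
      have n4 := margin_neg P c b
      have n5 := margin_neg P d b
      have n6 := margin_neg P d c
      rw [m1] at n1
      rw [m2] at n2
      rw [m3, neg_neg] at n3
      rw [m4] at n4
      rw [m5] at n5
      rw [m6] at n6
      rw [hcs]
      intro x hx y hy
      simp only [Finset.mem_insert, Finset.mem_singleton] at hx hy
      rcases hx with hx | hx | hx | hx <;> rcases hy with hy | hy | hy | hy <;> rw [hx, hy] <;>
        first
        | (rw [margin_self]; intro h; exact absurd h (lt_irrefl _))
        | (simp only [m1, m2, m3, m4, m5, m6, n1, n2, n3, n4, n5, n6]; first | apply W | apply W')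
  have n2 := margin_neg P c a
  have n3 := margin_neg P d a
  have n6 := margin_neg P d c
  have hap : a ∈ P.cands := by simp [hcs]
  have hbp : b ∈ P.cands := by simp [hcs]
  have hcp : c ∈ P.cands := by simp [hcs]
  have hdp : d ∈ P.cands := by simp [hcs]
  have dr : ∀ A hA hs, P.restrict A hA hs ∈ F.dom := by
    intro A hA hs
    rw [hd] at hPd ⊢
    exact dom_restrict P hPd A hA hs
  have e1 : P.cands.erase b = {d, a, c} := by
    rw [hcs]; ext z; simp only [Finset.mem_erase, Finset.mem_insert, Finset.mem_singleton]; grind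
  have e2 : P.cands.erase c = {a, b, d} := by
    rw [hcs]; ext z; simp only [Finset.mem_erase, Finset.mem_insert, Finset.mem_singleton]; grind
  have wa : a ∈ F.winners P := by
    have hne : (P.cands.erase b).Nonempty := ⟨a, by simp [e1]⟩
    apply hB P hPd a hap b hbp hab hne (dr _ _ _) (dr _ _ _)
    · have : F.winners (P.minus b hne) = {a} := by
        apply hA1 d hdd a ha c hc (by simp; grind) _ (dr _ _ _) e1
        all_goals
          exact (margin_restrict P (P.cands.erase b) hne _ _ _ (by simp [e1]) (by simp [e1])).trans
            (by omega)
      simp [this]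
    · apply hSB r a ha b hb hab _ (dr _ _ _) rfl
      exact (margin_restrict P {a, b} _ _ _ _ (by simp) (by simp)).trans (by omega)
  have wb : b ∈ F.winners P := by
    have hne : (P.cands.erase c).Nonempty := ⟨a, by simp [e2]⟩
    apply hB P hPd b hbp c hcp hbc hne (dr _ _ _) (dr _ _ _)
    · have : F.winners (P.minus c hne) = {b} := by
        apply hA2 a ha b hb d hdd (by simp; grind) _ (dr _ _ _) e2
        all_goals
          exact (margin_restrict P (P.cands.erase c) hne _ _ _ (by simp [e2]) (by simp [e2])).trans
            (by omega)
      simp [this]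
    · apply hSB t b hb c hc hbc _ (dr _ _ _) rfl
      exact (margin_restrict P {b, c} _ _ _ _ (by simp) (by simp)).trans (by omega)
  obtain ⟨z, hz⟩ := Finset.card_eq_one.1 (hQ P hPd (by rw [hd] at hPd; exact hPd.2.1))
  rw [hz, Finset.mem_singleton] at wa wb
  exact hab (wa.trans wb.symm)

end NPM

/-- For any finite set `Y` of candidates with `|Y| ≥ 4`, there is no
pairwise voting method, with domain the set of profiles `P` with `X(P) ⊆ Y` whose
margin graph is uniquely weighted with all weights in `{2,4,6,8,10,12}`, satisfying
anonymity, neutrality, binary γ, and quasi-resoluteness. -/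
theorem no_pairwise_method (C V : Type) [Infinite C] [Infinite V]
    (Y : Finset C) (hY : 4 ≤ Y.card) :
    ¬ ∃ F : VotingMethod C V,
      F.dom = {P : Profile C V | P.cands ⊆ Y ∧ P.UniquelyWeighted ∧
        ∀ x ∈ P.cands, ∀ y ∈ P.cands, 0 < P.margin x y →
          P.margin x y ∈ ({2, 4, 6, 8, 10, 12} : Set ℤ)} ∧
      F.Pairwise ∧ F.Anonymous ∧ F.Neutral ∧ F.BinaryGamma ∧ F.QuasiResolute := by
  rintro ⟨F, hd, hPw, -, hN, hB, hQ⟩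
  exact NPM.main C V Y hY F hd hPw hN hB hQ
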